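/- In the fragmented-society model, in any essential equilibrium σ, every platform (ℓ,C,S)∈Supp(σ) satisfies S⊆N∖N^h and C=N^ℓ∖S; in particular, no platform in Supp(σ) with policy ℓ carries a narrative S with 0∈S, a narrative S⊆N∖N^ℓ, or a nonempty narrative S⊆N^h∩N^ℓ. -/

import Mathlib

open Finset
open scoped Classical

/-- A policy: `l` (the "populist" policy ℓ) or `h` (the rational policy). -/
inductive Policy where
  | l : Policy
  | h : Policy
  deriving DecidableEq

instance : Fintype Policy :=
  ⟨{Policy.l, Policy.h}, fun x => by cases x <;> simp⟩

/-- A narrative `S ⊆ {0,…,n}`: the first component records whether the policy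
variable (index 0) belongs to `S`, the second records `S ∩ N`. -/
abbrev Narrative (n : ℕ) := Bool × Finset (Fin n)

/-- A platform: a policy, a coalition of social groups, and a narrative. -/
abbrev Platform (n : ℕ) := Policy × Finset (Fin n) × Narrative n

namespace FN

variable {n : ℕ}

/-- The true narrative `S = {0}`. -/
def trueNarr (n : ℕ) : Narrative n := (true, ∅)

/-- The denialist narrative `S = ∅`. -/
def denialNarr (n : ℕ) : Narrative n := (false, ∅)

/-- `x_S(a,C) = x_S(a',C')`: the variables postulated by the narrative `S` take the
same values at `(a,C)` and `(a',C')`. -/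
def Agrees (S : Narrative n) (a : Policy) (C : Finset (Fin n))
    (a' : Policy) (C' : Finset (Fin n)) : Prop :=
  (S.1 = true → a = a') ∧ ∀ i ∈ S.2, (i ∈ C ↔ i ∈ C')

/-- The long-run conditional probability `p_σ(y = 1 ∣ x_S(a,C))`: using
`Pr(y=1∣h) = q`, `Pr(y=1∣ℓ) = 0`, it is `q` times the σ-mass of platforms with
policy `h` agreeing with `(a,C)` on `S`, divided by the σ-mass of all platforms
agreeing with `(a,C)` on `S`. -/
noncomputable def condProb (q : ℝ) (σ : Platform n → ℝ) (a : Policy)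
    (C : Finset (Fin n)) (S : Narrative n) : ℝ :=
  (q * ∑ z ∈ univ.filter (fun z : Platform n =>
      z.1 = Policy.h ∧ Agrees S a C z.1 z.2.1), σ z) /
    ∑ z ∈ univ.filter (fun z : Platform n => Agrees S a C z.1 z.2.1), σ z

/-- The platform payoff `U_σ(a,C,S) = Σ_{i∈C} p_σ(y=1∣x_S(a,C)) · f_i(a)`. -/
noncomputable def payoff (q : ℝ) (f : Fin n → Policy → ℝ) (σ : Platform n → ℝ)
    (z : Platform n) : ℝ :=
  ∑ i ∈ z.2.1, condProb q σ z.1 z.2.1 z.2.2 * f i z.1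

/-- A coalition `C` is admissible given policy `a` if it is a nonempty strict
subset of `N` and every member intrinsically supports `a`. -/
def Admissible (f : Fin n → Policy → ℝ) (a : Policy) (C : Finset (Fin n)) : Prop :=
  C.Nonempty ∧ C ≠ univ ∧ ∀ i ∈ C, 0 < f i a

/-- A valid platform: admissible coalition and feasible narrative. -/
def Valid (f : Fin n → Policy → ℝ) (feas : Narrative n → Prop) (z : Platform n) : Prop :=
  Admissible f z.1 z.2.1 ∧ feas z.2.2

/-- `σ` is a probability distribution over platforms. -/
def IsDist (σ : Platform n → ℝ) : Prop :=
  (∀ z, 0 ≤ σ z) ∧ ∑ z, σ z = 1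

/-- An ε-equilibrium: a full-support distribution (over valid platforms) such that
every platform with probability above ε maximizes the payoff among valid platforms. -/
def EpsEquilibrium (q : ℝ) (f : Fin n → Policy → ℝ) (feas : Narrative n → Prop)
    (ε : ℝ) (σ : Platform n → ℝ) : Prop :=
  IsDist σ ∧ (∀ z, 0 < σ z ↔ Valid f feas z) ∧
    ∀ z, Valid f feas z → ε < σ z →
      ∀ z', Valid f feas z' → payoff q f σ z' ≤ payoff q f σ z

/-- An equilibrium: a (pointwise) limit of ε-equilibria as ε → 0. -/
def Equilibrium (q : ℝ) (f : Fin n → Policy → ℝ) (feas : Narrative n → Prop)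
    (σ : Platform n → ℝ) : Prop :=
  ∃ (ε : ℕ → ℝ) (σs : ℕ → Platform n → ℝ),
    (∀ k, 0 < ε k) ∧ Filter.Tendsto ε Filter.atTop (nhds 0) ∧
    (∀ k, EpsEquilibrium q f feas (ε k) (σs k)) ∧
    (∀ z, Filter.Tendsto (fun k => σs k z) Filter.atTop (nhds (σ z)))

/-- An essential equilibrium: supported platforms with a false narrative strictly
outperform the true narrative on the same policy-coalition pair, and supported
narratives `S ⊆ N` strictly outperform all strict subset narratives. -/
def Essential (q : ℝ) (f : Fin n → Policy → ℝ) (feas : Narrative n → Prop)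
    (σ : Platform n → ℝ) : Prop :=
  Equilibrium q f feas σ ∧
  (∀ a C (S : Narrative n), 0 < σ (a, C, S) → S ≠ trueNarr n →
      payoff q f σ (a, C, trueNarr n) < payoff q f σ (a, C, S)) ∧
  (∀ a C (S : Finset (Fin n)), 0 < σ (a, C, ((false, S) : Narrative n)) →
      ∀ S' : Finset (Fin n), S' ⊂ S →
        payoff q f σ (a, C, ((false, S') : Narrative n)) <
          payoff q f σ (a, C, ((false, S) : Narrative n)))

/-- `N^a`: the set of groups with positive mobilization potential for `a`. -/
noncomputable def Nset (f : Fin n → Policy → ℝ) (a : Policy) : Finset (Fin n) :=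
  univ.filter (fun i => 0 < f i a)

/-- `F(a,M) = Σ_{i∈M} f_i(a)`: the aggregate mobilization potential for `a` in `M`. -/
def Fval (f : Fin n → Policy → ℝ) (a : Policy) (M : Finset (Fin n)) : ℝ :=
  ∑ i ∈ M, f i a

/-- Standing assumptions on the mobilization potentials: nonnegativity, every group
supports some policy, every policy is supported by some group. -/
def FOK (f : Fin n → Policy → ℝ) : Prop :=
  (∀ i a, 0 ≤ f i a) ∧ (∀ i, ∃ a, 0 < f i a) ∧ (∀ a, ∃ i, 0 < f i a)

/-- Standing assumptions on the family `𝒮` in the fragmented-society model. -/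
def FamilyOK (f : Fin n → Policy → ℝ) (𝒮 : Finset (Finset (Fin n))) : Prop :=
  (univ \ Nset f Policy.h).Nonempty ∧ (univ \ Nset f Policy.l).Nonempty ∧
  (Nset f Policy.l ∩ Nset f Policy.h).Nonempty ∧
  univ \ Nset f Policy.h ∈ 𝒮 ∧ univ \ Nset f Policy.l ∈ 𝒮 ∧
  Nset f Policy.l ∩ Nset f Policy.h ∈ 𝒮 ∧ (∅ : Finset (Fin n)) ∈ 𝒮 ∧
  ∀ S ∈ 𝒮, S ⊆ univ \ Nset f Policy.h ∨ S ⊆ univ \ Nset f Policy.l ∨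
    S ⊆ Nset f Policy.l ∩ Nset f Policy.h

/-- In the fragmented-society model, a narrative is feasible iff `S ∖ {0} ∈ 𝒮`. -/
def fragFeas (𝒮 : Finset (Finset (Fin n))) : Narrative n → Prop :=
  fun S => S.2 ∈ 𝒮

end FN

namespace FN

variable {n : ℕ}

lemma payoff_eq (q : ℝ) (f : Fin n → Policy → ℝ) (σ : Platform n → ℝ) (a : Policy)
    (C : Finset (Fin n)) (S : Narrative n) :
    payoff q f σ (a, C, S) = condProb q σ a C S * Fval f a C := by
  simp [payoff, Fval, Finset.mul_sum]

lemma num_le_den (σ : Platform n → ℝ) (h0 : ∀ z, 0 ≤ σ z) (a : Policy)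
    (C : Finset (Fin n)) (S : Narrative n) :
    ∑ z ∈ univ.filter (fun z : Platform n => z.1 = Policy.h ∧ Agrees S a C z.1 z.2.1), σ z ≤
    ∑ z ∈ univ.filter (fun z : Platform n => Agrees S a C z.1 z.2.1), σ z := by
  apply Finset.sum_le_sum_of_subset_of_nonneg
  · intro z hz
    simp only [Finset.mem_filter] at hz ⊢
    exact ⟨hz.1, hz.2.2⟩
  · intro i _ _
    exact h0 i

lemma condProb_le (q : ℝ) (hq : 0 < q) (σ : Platform n → ℝ) (h0 : ∀ z, 0 ≤ σ z) (a : Policy)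
    (C : Finset (Fin n)) (S : Narrative n) : condProb q σ a C S ≤ q := by
  unfold condProb
  apply div_le_of_le_mul₀
  · exact Finset.sum_nonneg fun z _ => h0 z
  · exact hq.le
  · exact mul_le_mul_of_nonneg_left (num_le_den σ h0 a C S) hq.le

lemma condProb_true (q : ℝ) (σ : Platform n → ℝ) (h0 : ∀ z, 0 ≤ σ z)
    (C : Finset (Fin n)) (z : Platform n) (hz : z.1 = Policy.h) (hp : 0 < σ z) :
    condProb q σ Policy.h C (trueNarr n) = q := by
  unfold condProb
  have e : univ.filter (fun z : Platform n =>
      z.1 = Policy.h ∧ Agrees (trueNarr n) Policy.h C z.1 z.2.1) =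
      univ.filter (fun z : Platform n => Agrees (trueNarr n) Policy.h C z.1 z.2.1) := by
    apply Finset.filter_congr
    intro z _
    constructor
    · exact fun h => h.2
    · intro h
      exact ⟨(h.1 rfl).symm, h⟩
  rw [e]
  apply mul_div_cancel_right₀
  apply ne_of_gt
  apply Finset.sum_pos'
  · exact fun z _ => h0 z
  · refine ⟨z, ?_, hp⟩
    simp [Agrees, trueNarr, hz]

lemma condProb_pos_exists (q : ℝ) (σ : Platform n → ℝ) (h0 : ∀ z, 0 ≤ σ z) (a : Policy)
    (C : Finset (Fin n)) (S : Narrative n) (h : 0 < condProb q σ a C S) :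
    ∃ z : Platform n, z.1 = Policy.h ∧ Agrees S a C z.1 z.2.1 ∧ 0 < σ z := by
  by_contra! hc
  have e : ∑ z ∈ univ.filter (fun z : Platform n =>
      z.1 = Policy.h ∧ Agrees S a C z.1 z.2.1), σ z = 0 := by
    apply Finset.sum_eq_zero
    intro z hz
    simp only [Finset.mem_filter] at hz
    exact le_antisymm (hc z hz.2.1 hz.2.2) (h0 z)
  unfold condProb at h
  rw [e] at h
  simp at h

lemma den_split (σ : Platform n → ℝ) (h0 : ∀ z, 0 ≤ σ z) (a : Policy)
    (C : Finset (Fin n)) (S : Narrative n)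
    (hl : ∀ z : Platform n, 0 < σ z → z.1 = Policy.l → Agrees S a C z.1 z.2.1) :
    ∑ z ∈ univ.filter (fun z : Platform n => Agrees S a C z.1 z.2.1), σ z =
    ∑ z ∈ univ.filter (fun z : Platform n => z.1 = Policy.h ∧ Agrees S a C z.1 z.2.1), σ z +
    ∑ z ∈ univ.filter (fun z : Platform n => z.1 = Policy.l), σ z := by
  rw [Finset.sum_filter, Finset.sum_filter, Finset.sum_filter, ← Finset.sum_add_distrib]
  apply Finset.sum_congr rfl
  intro z _
  rcases hz : z.1 with _ | _
  · rcases (h0 z).eq_or_lt with h | h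
    · simp [← h]
    · have := hl z h hz
      rw [hz] at this
      simp [this]
  · simp

lemma cond_le_denial (q : ℝ) (hq : 0 < q) (σ : Platform n → ℝ) (h0 : ∀ z, 0 ≤ σ z) (a : Policy)
    (C : Finset (Fin n)) (S : Narrative n) (hp : 0 < condProb q σ a C S)
    (hl : ∀ z : Platform n, 0 < σ z → z.1 = Policy.l → Agrees S a C z.1 z.2.1) :
    condProb q σ a C S ≤ condProb q σ a C (false, ∅) := by
  have e1 := den_split σ h0 a C S hl
  have e2 := den_split σ h0 a C (false, ∅) (by intro z _ _; simp [Agrees])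
  have hA : ∑ z ∈ univ.filter (fun z : Platform n => z.1 = Policy.h ∧ Agrees S a C z.1 z.2.1), σ z
      ≤ ∑ z ∈ univ.filter (fun z : Platform n => z.1 = Policy.h ∧
        Agrees ((false, ∅) : Narrative n) a C z.1 z.2.1), σ z := by
    apply Finset.sum_le_sum_of_subset_of_nonneg
    · intro z hz
      simp only [Finset.mem_filter] at hz ⊢
      exact ⟨hz.1, hz.2.1, by simp [Agrees]⟩
    · intro i _ _
      exact h0 i
  have hL : 0 ≤ ∑ z ∈ univ.filter (fun z : Platform n => z.1 = Policy.l), σ z :=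
    Finset.sum_nonneg fun z _ => h0 z
  have hA0 : 0 < ∑ z ∈ univ.filter (fun z : Platform n =>
      z.1 = Policy.h ∧ Agrees S a C z.1 z.2.1), σ z := by
    obtain ⟨z, h1, h2, h3⟩ := condProb_pos_exists q σ h0 a C S hp
    apply Finset.sum_pos'
    · exact fun z _ => h0 z
    · exact ⟨z, by simp [h1]; rw [← h1]; exact h2, h3⟩
  unfold condProb
  rw [e1, e2]
  generalize ∑ z ∈ univ.filter (fun z : Platform n => z.1 = Policy.l), σ z = L at *
  generalize ∑ z ∈ univ.filter (fun z : Platform n =>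
      z.1 = Policy.h ∧ Agrees S a C z.1 z.2.1), σ z = A at *
  generalize ∑ z ∈ univ.filter (fun z : Platform n => z.1 = Policy.h ∧
        Agrees ((false, ∅) : Narrative n) a C z.1 z.2.1), σ z = B at *
  rw [div_le_div_iff₀ (by linarith) (by linarith)]
  nlinarith [mul_le_mul_of_nonneg_right hA (mul_nonneg hq.le hL)]

lemma supp_opt {q : ℝ} {f : Fin n → Policy → ℝ} {feas : Narrative n → Prop}
    {σ : Platform n → ℝ} (h : Equilibrium q f feas σ) (z : Platform n) (hz : 0 < σ z) :
    ∃ τ : Platform n → ℝ, (∀ z, 0 ≤ τ z) ∧ (∀ z, 0 < τ z ↔ Valid f feas z) ∧ Valid f feas z ∧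
      ∀ z', Valid f feas z' → payoff q f τ z' ≤ payoff q f τ z := by
  obtain ⟨ε, σs, hε, hε0, hs, hlim⟩ := h
  obtain ⟨k, hk⟩ := (hε0.eventually_lt (hlim z) hz).exists
  obtain ⟨h1, h2, h3⟩ := hs k
  have hv := (h2 z).1 ((hε k).trans hk)
  exact ⟨σs k, h1.1, h2, hv, h3 z hv hk⟩

lemma eq_nonneg {q : ℝ} {f : Fin n → Policy → ℝ} {feas : Narrative n → Prop}
    {σ : Platform n → ℝ} (h : Equilibrium q f feas σ) (z : Platform n) : 0 ≤ σ z := by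
  obtain ⟨ε, σs, hε, hε0, hs, hlim⟩ := h
  exact ge_of_tendsto' (hlim z) fun k => (hs k).1.1 z

lemma eq_of_Fval_le {f : Fin n → Policy → ℝ} {a : Policy} {C D : Finset (Fin n)}
    (hCD : C ⊆ D) (hD : ∀ i ∈ D, 0 < f i a) (h : Fval f a D ≤ Fval f a C) : C = D := by
  by_contra hne
  obtain ⟨i, hi, hi'⟩ := Finset.exists_of_ssubset (hCD.ssubset_of_ne hne)
  have := Finset.sum_lt_sum_of_subset (f := fun i => f i a) hCD hi hi' (hD i hi)
    (fun j hj _ => (hD j hj).le)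
  unfold Fval at h
  linarith

lemma Fval_pos {f : Fin n → Policy → ℝ} {a : Policy} {C : Finset (Fin n)}
    (h : Admissible f a C) : 0 < Fval f a C :=
  Finset.sum_pos h.2.2 h.1

lemma adm_Nset {f : Fin n → Policy → ℝ} (hf : FOK f) (a : Policy)
    (h : (univ \ Nset f a).Nonempty) : Admissible f a (Nset f a) := by
  refine ⟨?_, ?_, ?_⟩
  · obtain ⟨i, hi⟩ := hf.2.2 a
    exact ⟨i, by simp [Nset, hi]⟩
  · intro e
    rw [e] at h
    simp at h
  · intro i hi
    simpa [Nset] using hi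

lemma condProb_congr (q : ℝ) (σ : Platform n → ℝ) (a : Policy) {C D : Finset (Fin n)}
    (S : Narrative n) (h : ∀ i ∈ S.2, (i ∈ C ↔ i ∈ D)) :
    condProb q σ a C S = condProb q σ a D S := by
  have e : ∀ z : Platform n, Agrees S a C z.1 z.2.1 ↔ Agrees S a D z.1 z.2.1 := by
    intro z
    unfold Agrees
    refine and_congr Iff.rfl ?_
    refine forall₂_congr fun i hi => ?_
    rw [h i hi]
  unfold condProb
  simp only [e]

section
variable {q : ℝ} {f : Fin n → Policy → ℝ} {𝒮 : Finset (Finset (Fin n))} {σ : Platform n → ℝ}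

/-- On-support facts. -/
lemma supp_facts (hq0 : 0 < q) (hf : FOK f) (h𝒮 : FamilyOK f 𝒮)
    (hσ : Equilibrium q f (fragFeas 𝒮) σ) (a : Policy) (C : Finset (Fin n)) (S : Narrative n)
    (hz : 0 < σ (a, C, S)) :
    Admissible f a C ∧ S.2 ∈ 𝒮 ∧ ∃ τ : Platform n → ℝ, (∀ z, 0 ≤ τ z) ∧
      0 < condProb q τ a C S ∧
      q * Fval f Policy.h (Nset f Policy.h) ≤ condProb q τ a C S * Fval f a C ∧
      (∀ D, Admissible f a D → (∀ i ∈ S.2, (i ∈ C ↔ i ∈ D)) → Fval f a D ≤ Fval f a C) := by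
  obtain ⟨τ, t0, tv, hv, hopt⟩ := supp_opt hσ _ hz
  have hh := adm_Nset hf Policy.h h𝒮.1
  have hvh : Valid f (fragFeas 𝒮) (Policy.h, Nset f Policy.h, trueNarr n) :=
    ⟨hh, h𝒮.2.2.2.2.2.2.1⟩
  have h1 := hopt _ hvh
  rw [payoff_eq, payoff_eq, condProb_true q τ t0 _ _ rfl ((tv _).2 hvh)] at h1
  have hF := Fval_pos hh
  have hFC := Fval_pos hv.1
  have hc : 0 < condProb q τ a C S := by
    have : 0 < condProb q τ a C S * Fval f a C := lt_of_lt_of_le (mul_pos hq0 hF) h1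
    exact pos_of_mul_pos_left this hFC.le
  refine ⟨hv.1, hv.2, τ, t0, hc, h1, ?_⟩
  intro D hD hag
  have h2 := hopt (a, D, S) ⟨hD, hv.2⟩
  rw [payoff_eq, payoff_eq, ← condProb_congr q τ a S hag] at h2
  exact le_of_mul_le_mul_left h2 hc

lemma supp_h (hq0 : 0 < q) (hf : FOK f) (h𝒮 : FamilyOK f 𝒮)
    (hσ : Equilibrium q f (fragFeas 𝒮) σ) (C : Finset (Fin n)) (S : Narrative n)
    (hz : 0 < σ (Policy.h, C, S)) : C = Nset f Policy.h := by
  obtain ⟨hadm, -, τ, t0, hc, h1, -⟩ := supp_facts hq0 hf h𝒮 hσ _ C S hz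
  have hh := adm_Nset hf Policy.h h𝒮.1
  apply eq_of_Fval_le _ hh.2.2
  · have h2 : condProb q τ Policy.h C S * Fval f Policy.h C ≤ q * Fval f Policy.h C :=
      mul_le_mul_of_nonneg_right (condProb_le q hq0 τ t0 _ _ _) (Fval_pos hadm).le
    exact le_of_mul_le_mul_left (h1.trans h2) hq0
  · intro i hi
    simp [Nset, hadm.2.2 i hi]

lemma supp_l_pos (hq0 : 0 < q) (hf : FOK f) (h𝒮 : FamilyOK f 𝒮)
    (hσ : Essential q f (fragFeas 𝒮) σ) (C : Finset (Fin n)) (S : Narrative n)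
    (hz : 0 < σ (Policy.l, C, S)) :
    S.1 = false ∧ 0 < condProb q σ Policy.l C S ∧ ∀ i ∈ S.2, (i ∈ C ↔ i ∈ Nset f Policy.h) := by
  obtain ⟨hadm, -, τ, t0, hc, h1, -⟩ := supp_facts hq0 hf h𝒮 hσ.1 _ C S hz
  have hS : S.1 = false := by
    obtain ⟨z, hz1, hz2, -⟩ := condProb_pos_exists q τ t0 _ _ _ hc
    by_contra hne
    have := hz2.1 (by simpa using hne)
    rw [hz1] at this
    cases this
  have h0 := eq_nonneg hσ.1
  have hp : 0 < condProb q σ Policy.l C S := by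
    have h2 := hσ.2.1 _ C S hz (by rintro rfl; simp [trueNarr] at hS)
    rw [payoff_eq, payoff_eq] at h2
    have h3 := lt_of_mul_lt_mul_right h2 (Fval_pos hadm).le
    refine lt_of_le_of_lt ?_ h3
    unfold condProb
    exact div_nonneg (mul_nonneg hq0.le (Finset.sum_nonneg fun z _ => h0 z))
      (Finset.sum_nonneg fun z _ => h0 z)
  refine ⟨hS, hp, ?_⟩
  obtain ⟨⟨a, D, T⟩, hz1, hz2, hz3⟩ := condProb_pos_exists q σ h0 _ _ _ hp
  simp only at hz1 hz2
  subst hz1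
  have := supp_h hq0 hf h𝒮 hσ.1 D T hz3
  subst this
  exact hz2.2

lemma supp_l_form (hq0 : 0 < q) (hf : FOK f) (h𝒮 : FamilyOK f 𝒮)
    (hσ : Essential q f (fragFeas 𝒮) σ) (C : Finset (Fin n)) (S : Narrative n)
    (hz : 0 < σ (Policy.l, C, S)) :
    (S.2 ⊆ univ \ Nset f Policy.h ∧ C = Nset f Policy.l \ S.2) ∨
    (S.2.Nonempty ∧ S.2 ⊆ univ \ Nset f Policy.l) ∨
    (S.2.Nonempty ∧ S.2 ⊆ Nset f Policy.l ∩ Nset f Policy.h ∧ C = Nset f Policy.l) := by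
  obtain ⟨hadm, hS, τ, t0, hc, h1, hD⟩ := supp_facts hq0 hf h𝒮 hσ.1 _ C S hz
  obtain ⟨hS1, hp, hag⟩ := supp_l_pos hq0 hf h𝒮 hσ C S hz
  have hl := adm_Nset hf Policy.l h𝒮.2.1
  have hCl : C ⊆ Nset f Policy.l := by
    intro i hi
    simp [Nset, hadm.2.2 i hi]
  have key1 : S.2 ⊆ univ \ Nset f Policy.h →
      S.2 ⊆ univ \ Nset f Policy.h ∧ C = Nset f Policy.l \ S.2 := by
    intro hs
    refine ⟨hs, ?_⟩
    have hnot : ∀ i ∈ S.2, i ∉ C := by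
      intro i hi hiC
      have := hs hi
      simp only [Finset.mem_sdiff] at this
      exact this.2 ((hag i hi).1 hiC)
    have hsub : C ⊆ Nset f Policy.l \ S.2 := by
      intro i hi
      rw [Finset.mem_sdiff]
      exact ⟨hCl hi, fun h => hnot i h hi⟩
    have hpos : ∀ i ∈ Nset f Policy.l \ S.2, 0 < f i Policy.l :=
      fun i hi => hl.2.2 i (Finset.mem_sdiff.1 hi).1
    apply eq_of_Fval_le hsub hpos
    apply hD
    · refine ⟨hadm.1.mono hsub, ?_, hpos⟩
      intro e
      apply hl.2.1
      rw [Finset.eq_univ_iff_forall] at e ⊢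
      exact fun i => (Finset.mem_sdiff.1 (e i)).1
    · intro i hi
      simp [hnot i hi, hi]
  rcases S.2.eq_empty_or_nonempty with he | hne
  · left
    apply key1
    simp [he]
  rcases h𝒮.2.2.2.2.2.2.2 _ hS with h | h | h
  · exact Or.inl (key1 h)
  · exact Or.inr (Or.inl ⟨hne, h⟩)
  · refine Or.inr (Or.inr ⟨hne, h, ?_⟩)
    apply eq_of_Fval_le hCl hl.2.2
    apply hD _ hl
    intro i hi
    have := Finset.mem_inter.1 (h hi)
    rw [hag i hi]
    simp [this]

lemma supp_l_noden (hq0 : 0 < q) (hf : FOK f) (h𝒮 : FamilyOK f 𝒮)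
    (hσ : Essential q f (fragFeas 𝒮) σ) (C : Finset (Fin n)) (S : Narrative n)
    (hz : 0 < σ (Policy.l, C, S)) (hne : S.2.Nonempty)
    (hl : ∀ D T, 0 < σ (Policy.l, D, T) → ∀ i ∈ S.2, (i ∈ C ↔ i ∈ D)) : False := by
  obtain ⟨hS1, hp, hag⟩ := supp_l_pos hq0 hf h𝒮 hσ C S hz
  obtain ⟨hadm, -, -⟩ := supp_facts hq0 hf h𝒮 hσ.1 _ C S hz
  obtain ⟨b, S⟩ := S
  simp only at hS1 hne
  subst hS1
  have h2 := hσ.2.2 _ C S hz ∅ (Finset.empty_ssubset.2 hne)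
  rw [payoff_eq, payoff_eq] at h2
  have h3 := lt_of_mul_lt_mul_right h2 (Fval_pos hadm).le
  have h4 := cond_le_denial q hq0 σ (eq_nonneg hσ.1) Policy.l C (false, S) hp (by
    rintro ⟨a, D, T⟩ h5 h6
    simp only at h6
    subst h6
    exact ⟨fun _ => rfl, hl D T h5⟩)
  linarith

end

end FN

/-- In the fragmented-society model, in any essential equilibrium `σ`,
every platform `(ℓ,C,S)` in the support of `σ` satisfies `S ⊆ N ∖ N^h` and
`C = N^ℓ ∖ S`; in particular, no platform in the support with policy `ℓ` carries a
narrative `S` with `0 ∈ S`, a (nonempty) narrative `S ⊆ N ∖ N^ℓ`, or a nonempty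
narrative `S ⊆ N^h ∩ N^ℓ`. -/
theorem frag_exclusionary_form
    (n : ℕ) (q : ℝ) (hq0 : 0 < q) (hq1 : q ≤ 1)
    (f : Fin n → Policy → ℝ) (hf : FN.FOK f)
    (𝒮 : Finset (Finset (Fin n))) (h𝒮 : FN.FamilyOK f 𝒮)
    (σ : Platform n → ℝ) (hσ : FN.Essential q f (FN.fragFeas 𝒮) σ) :
    ∀ (C : Finset (Fin n)) (S : Narrative n), 0 < σ (Policy.l, C, S) →
      (S.1 = false ∧ S.2 ⊆ univ \ FN.Nset f Policy.h ∧
        C = FN.Nset f Policy.l \ S.2) ∧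
      ¬ (S.2.Nonempty ∧ S.2 ⊆ univ \ FN.Nset f Policy.l) ∧
      ¬ (S.2.Nonempty ∧ S.2 ⊆ FN.Nset f Policy.h ∩ FN.Nset f Policy.l) := by
  intro C S hz
  obtain ⟨hS1, hp, hag⟩ := FN.supp_l_pos hq0 hf h𝒮 hσ C S hz
  have hnol : ∀ C S, 0 < σ (Policy.l, C, S) →
      ¬ (S.2.Nonempty ∧ S.2 ⊆ univ \ FN.Nset f Policy.l) := by
    rintro C S hz ⟨hne, hs⟩
    refine FN.supp_l_noden hq0 hf h𝒮 hσ C S hz hne ?_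
    have aux : ∀ D T, 0 < σ (Policy.l, D, T) → ∀ i ∈ S.2, i ∉ D := by
      intro D T hT i hi hD
      have h1 := (FN.supp_facts hq0 hf h𝒮 hσ.1 _ D T hT).1.2.2 i hD
      have h2 := hs hi
      simp [FN.Nset] at h2
      linarith
    intro D T hT i hi
    simp [aux C S hz i hi, aux D T hT i hi]
  have hnoi : ¬ (S.2.Nonempty ∧ S.2 ⊆ FN.Nset f Policy.h ∩ FN.Nset f Policy.l) := by
    rintro ⟨hne, hs⟩
    refine FN.supp_l_noden hq0 hf h𝒮 hσ C S hz hne ?_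
    have aux : ∀ D T, 0 < σ (Policy.l, D, T) → ∀ i ∈ S.2, i ∈ D := by
      intro D T hT i hi
      have h2 := Finset.mem_inter.1 (hs hi)
      rcases FN.supp_l_form hq0 hf h𝒮 hσ D T hT with ⟨h3, h4⟩ | h3 | ⟨_, _, h4⟩
      · rw [h4, Finset.mem_sdiff]
        exact ⟨h2.2, fun h => (Finset.mem_sdiff.1 (h3 h)).2 h2.1⟩
      · exact absurd h3 (hnol D T hT)
      · rw [h4]
        exact h2.2
    intro D T hT i hi
    simp [aux C S hz i hi, aux D T hT i hi]
  refine ⟨⟨hS1, ?_⟩, hnol C S hz, hnoi⟩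
  rcases FN.supp_l_form hq0 hf h𝒮 hσ C S hz with h3 | h3 | ⟨h3, h4, _⟩
  · exact h3
  · exact absurd h3 (hnol C S hz)
  · rw [Finset.inter_comm] at h4
    exact absurd ⟨h3, h4⟩ hnoi
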